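/- arXiv:2011.08557 — 12 statements merged into one kernel-verified Lean document; each statement's English description precedes it below -/
import Mathlib

section
/- Let ρ > 0, ε > 0, and let x, y, z ∈ ℝⁿ with ‖x‖ ≤ ρ, ‖y‖ ≤ ρ, ‖z‖ ≤ ρ. If ⟨x−y, x−z⟩ ≥ ε·‖x−z‖², then dist([x,y], z)² ≤ (1 − (ε²/(4ρ²))·‖x−z‖²)·‖x−z‖². -/
open scoped RealInnerProductSpace

theorem infDist_segment_sq_le {E : Type*} [NormedAddCommGroup E] [InnerProductSpace ℝ E]
    (x y z : E) {t : ℝ} (ht₀ : 0 ≤ t) (ht₁ : t ≤ 1) :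
    Metric.infDist z (segment ℝ x y) ^ 2 ≤
      ‖x - z‖ ^ 2 - 2 * t * ⟪x - y, x - z⟫ + t ^ 2 * ‖x - y‖ ^ 2 := by
  have hmem : x - t • (x - y) ∈ segment ℝ x y :=
    ⟨1 - t, t, by linarith, ht₀, by ring, by module⟩
  calc Metric.infDist z (segment ℝ x y) ^ 2
      ≤ dist z (x - t • (x - y)) ^ 2 :=
        pow_le_pow_left₀ Metric.infDist_nonneg (Metric.infDist_le_dist_of_mem hmem) 2
    _ = ‖(x - z) - t • (x - y)‖ ^ 2 := by
        rw [dist_comm, dist_eq_norm, sub_right_comm]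
    _ = _ := by
        rw [norm_sub_sq_real, inner_smul_right, real_inner_comm, norm_smul, mul_pow,
          Real.norm_eq_abs, sq_abs]
        ring

theorem stmt_0 {n : ℕ} (ρ ε : ℝ) (hρ : 0 < ρ) (hε : 0 < ε)
    (x y z : EuclideanSpace ℝ (Fin n))
    (hx : ‖x‖ ≤ ρ) (hy : ‖y‖ ≤ ρ) (hz : ‖z‖ ≤ ρ)
    (h : ε * ‖x - z‖ ^ 2 ≤ ⟪x - y, x - z⟫) :
    Metric.infDist z (segment ℝ x y) ^ 2 ≤
      (1 - ε ^ 2 / (4 * ρ ^ 2) * ‖x - z‖ ^ 2) * ‖x - z‖ ^ 2 := by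
  have hxy : ‖x - y‖ ≤ 2 * ρ := (norm_sub_le x y).trans (by linarith)
  have hxz : ‖x - z‖ ≤ 2 * ρ := (norm_sub_le x z).trans (by linarith)
  have hA : ‖x - y‖ ^ 2 ≤ 4 * ρ ^ 2 := by nlinarith [norm_nonneg (x - y)]
  have hs : ⟪x - y, x - z⟫ ≤ 4 * ρ ^ 2 :=
    calc ⟪x - y, x - z⟫ ≤ ‖x - y‖ * ‖x - z‖ := real_inner_le_norm _ _
      _ ≤ (2 * ρ) * (2 * ρ) := by gcongr
      _ = 4 * ρ ^ 2 := by ring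
  have hs₀ : 0 ≤ ⟪x - y, x - z⟫ := le_trans (by positivity) h
  have hsq : (ε * ‖x - z‖ ^ 2) ^ 2 ≤ ⟪x - y, x - z⟫ ^ 2 :=
    pow_le_pow_left₀ (by positivity) h 2
  have key := @infDist_segment_sq_le _ _ _ x y z
  generalize ⟪x - y, x - z⟫ = s at *
  have hrhs : (1 - ε ^ 2 / (4 * ρ ^ 2) * ‖x - z‖ ^ 2) * ‖x - z‖ ^ 2 =
      ‖x - z‖ ^ 2 - (ε * ‖x - z‖ ^ 2) ^ 2 / (4 * ρ ^ 2) := by ring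
  rw [hrhs]
  rcases le_or_gt (‖x - y‖ ^ 2) s with hle | hlt
  · have hbound : (ε * ‖x - z‖ ^ 2) ^ 2 / (4 * ρ ^ 2) ≤ s := by
      rw [div_le_iff₀ (by positivity)]
      nlinarith
    have := key zero_le_one le_rfl
    linarith
  · have hpos : 0 < ‖x - y‖ ^ 2 := hs₀.trans_lt hlt
    have hbound : (ε * ‖x - z‖ ^ 2) ^ 2 / (4 * ρ ^ 2) ≤ s ^ 2 / ‖x - y‖ ^ 2 := by
      gcongr
    have hmin := key (t := s / ‖x - y‖ ^ 2) (by positivity) ((div_le_one hpos).2 hlt.le)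
    have heq : ‖x - z‖ ^ 2 - 2 * (s / ‖x - y‖ ^ 2) * s + (s / ‖x - y‖ ^ 2) ^ 2 * ‖x - y‖ ^ 2 =
        ‖x - z‖ ^ 2 - s ^ 2 / ‖x - y‖ ^ 2 := by
      field_simp
      ring
    linarith
end

section
/- Let t ≥ 1 be an integer, let d₁, …, d_t > 0 be real numbers and η > 0 be such that d_{i+1} ≤ (1 − η·d_i)·d_i for all i = 1, …, t−1 and 1/d₁ ≥ η. Then d_t ≤ 1/(t·η). -/
theorem stmt_2 (t : ℕ) (ht : 1 ≤ t) (d : ℕ → ℝ) (η : ℝ) (hη : 0 < η)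
    (hpos : ∀ i, 1 ≤ i → i ≤ t → 0 < d i)
    (hrec : ∀ i, 1 ≤ i → i + 1 ≤ t → d (i + 1) ≤ (1 - η * d i) * d i)
    (hinit : η ≤ 1 / d 1) :
    d t ≤ 1 / ((t : ℝ) * η) := by
  have key : ∀ k, 1 ≤ k → k ≤ t → (k : ℝ) * (η * d k) ≤ 1 := by
    intro k hk
    induction k, hk using Nat.le_induction with
    | base =>
      intro h
      simpa using (le_div_iff₀ (hpos 1 le_rfl h)).1 hinit
    | succ k hk ih =>
      intro h
      have hx : 0 < η * d k := mul_pos hη (hpos k hk (by omega))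
      have hkx := ih (by omega)
      have hy : η * d (k + 1) ≤ (1 - η * d k) * (η * d k) := by
        calc η * d (k + 1) ≤ η * ((1 - η * d k) * d k) :=
              mul_le_mul_of_nonneg_left (hrec k hk h) hη.le
          _ = (1 - η * d k) * (η * d k) := by ring
      generalize η * d k = x at *
      have hk' : (1 : ℝ) ≤ k := by exact_mod_cast hk
      have hx1 : x ≤ 1 := (le_mul_of_one_le_left hx.le hk').trans hkx
      push_cast
      calc ((k : ℝ) + 1) * (η * d (k + 1)) ≤ (k + 1) * ((1 - x) * x) :=
            mul_le_mul_of_nonneg_left hy (by positivity)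
        _ = (1 - x) * (k * x) + (1 - x) * x := by ring
        _ ≤ (1 - x) * 1 + (1 - x) * x := by
            gcongr
        _ ≤ 1 := by nlinarith [sq_nonneg x]
  have ht' : (0 : ℝ) < t := by exact_mod_cast ht
  rw [le_div_iff₀ (mul_pos ht' hη)]
  linarith [key t ht le_rfl]
end

section
/- Let ρ > 0 and let f, q ∈ ℝⁿ with ‖f‖ ≤ ρ, ‖q‖ ≤ ρ, and ⟨f−q, f+q⟩ ≤ 0. Then dist([q, 0], f)² ≤ (1 − ‖f−q‖²/(16ρ²))·‖f−q‖². -/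
open scoped RealInnerProductSpace

theorem stmt_5 {n : ℕ} (ρ : ℝ) (hρ : 0 < ρ) (f q : EuclideanSpace ℝ (Fin n))
    (hf : ‖f‖ ≤ ρ) (hq : ‖q‖ ≤ ρ) (h : ⟪f - q, f + q⟫ ≤ 0) :
    Metric.infDist f (segment ℝ q 0) ^ 2 ≤
      (1 - ‖f - q‖ ^ 2 / (16 * ρ ^ 2)) * ‖f - q‖ ^ 2 := by
  have hD : ‖f - q‖ ≤ 2 * ρ := (norm_sub_le f q).trans (by linarith)
  have hD2 : ‖f - q‖ ^ 2 ≤ 4 * ρ ^ 2 := by nlinarith [norm_nonneg (f - q)]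
  have hQ : ‖q‖ ^ 2 ≤ ρ ^ 2 := by gcongr
  have hinner : ‖f - q‖ ^ 2 + 2 * ⟪f - q, q⟫ ≤ 0 := by
    have hsum : f + q = (f - q) + (2 : ℝ) • q := by module
    rwa [hsum, inner_add_right, real_inner_smul_right, real_inner_self_eq_norm_sq] at h
  obtain ⟨t, ht⟩ : ∃ t, t = ‖f - q‖ ^ 2 / (4 * ρ ^ 2) := ⟨_, rfl⟩
  have ht0 : 0 ≤ t := by rw [ht]; positivity
  have ht1 : t ≤ 1 := by rw [ht]; exact div_le_one_of_le₀ hD2 (by positivity)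
  have hDt : ‖f - q‖ ^ 2 = 4 * ρ ^ 2 * t := by rw [ht]; field_simp
  have hmem : (1 - t) • q ∈ segment ℝ q 0 :=
    ⟨1 - t, t, by linarith, ht0, by ring, by simp⟩
  have hdist : ‖f - (1 - t) • q‖ ^ 2 =
      ‖f - q‖ ^ 2 + 2 * (t * ⟪f - q, q⟫) + t ^ 2 * ‖q‖ ^ 2 := by
    have hsub : f - (1 - t) • q = (f - q) + t • q := by module
    rw [hsub, norm_add_sq_real, real_inner_smul_right, norm_smul, mul_pow, Real.norm_eq_abs,
      sq_abs]
  have hratio : ‖f - q‖ ^ 2 / (16 * ρ ^ 2) = t / 4 := by rw [ht]; field_simp; norm_num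
  calc Metric.infDist f (segment ℝ q 0) ^ 2
      ≤ ‖f - (1 - t) • q‖ ^ 2 := by
        rw [← dist_eq_norm]
        exact pow_le_pow_left₀ Metric.infDist_nonneg (Metric.infDist_le_dist_of_mem hmem) 2
    _ ≤ (1 - ‖f - q‖ ^ 2 / (16 * ρ ^ 2)) * ‖f - q‖ ^ 2 := by
        rw [hdist, hratio]
        rw [hDt] at hinner ⊢
        nlinarith [mul_nonneg ht0 (neg_nonneg.2 hinner),
          mul_le_mul_of_nonneg_left hQ (sq_nonneg t), mul_nonneg (sq_nonneg t) (sq_nonneg ρ)]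
end

section
/- Let ρ > 0, let c ∈ ℝⁿ with c ≠ 0, let γ > 0, set f = c/γ, and assume ‖f‖ ≤ ρ. Let q ∈ ℝⁿ satisfy ⟨f−q, f+q⟩ > 0, set x = (2/⟨f−q, f+q⟩)·(f−q), γ' = ⟨c, x⟩, and f' = c/γ'. Then γ' ≥ γ > 0, and min{‖f' − p‖² : p ∈ [0, q]} ≤ (1 − ‖f−q‖²/(4ρ²))·‖f−q‖². -/
open scoped RealInnerProductSpace

/-- For `F = ‖f‖²`, `Q = ‖q‖²`, `s = ⟪f, q⟫`, this bounds the squared ratio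
`((F - Q) / (2 * (F - s)))²` by `1 - ‖f - q‖² / (4 * F)`, with denominators cleared. -/
lemma sq_sub_mul_le_of_sq_le_mul {F Q s : ℝ} (hs : s ^ 2 ≤ F * Q) (hQF : Q ≤ F) (hsF : s ≤ F) :
    (F - Q) ^ 2 * F ≤ (F - s) ^ 2 * (3 * F + 2 * s - Q) := by
  have h₁ : 0 ≤ 2 * (F - s) * (F * Q - s ^ 2) :=
    mul_nonneg (by linarith) (by linarith)
  have h₂ : 0 ≤ (F - Q) * (2 * (F - s) ^ 2 + (F * Q - s ^ 2)) :=
    mul_nonneg (by linarith) (by nlinarith [sq_nonneg (F - s)])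
  linear_combination h₁ + h₂

theorem stmt_6 {n : ℕ} (ρ : ℝ) (hρ : 0 < ρ) (c : EuclideanSpace ℝ (Fin n)) (hc : c ≠ 0)
    (γ : ℝ) (hγ : 0 < γ) (f q x f' : EuclideanSpace ℝ (Fin n)) (γ' : ℝ)
    (hf : f = γ⁻¹ • c) (hfρ : ‖f‖ ≤ ρ) (hpos : 0 < ⟪f - q, f + q⟫)
    (hx : x = (2 / ⟪f - q, f + q⟫) • (f - q))
    (hγ' : γ' = ⟪c, x⟫) (hf' : f' = γ'⁻¹ • c) :
    γ ≤ γ' ∧ 0 < γ ∧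
      Metric.infDist f' (segment ℝ 0 q) ^ 2 ≤
        (1 - ‖f - q‖ ^ 2 / (4 * ρ ^ 2)) * ‖f - q‖ ^ 2 := by
  have hcf : c = γ • f := by rw [hf, smul_inv_smul₀ hγ.ne']
  have hD : ⟪f - q, f + q⟫ = ‖f‖ ^ 2 - ‖q‖ ^ 2 := by
    simp only [inner_sub_left, inner_add_right, real_inner_self_eq_norm_sq,
      real_inner_comm f q]
    ring
  have hd := norm_sub_sq_real f q
  have hγ'_eq : γ' = γ * (2 * (‖f‖ ^ 2 - ⟪f, q⟫) / (‖f‖ ^ 2 - ‖q‖ ^ 2)) := by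
    rw [hγ', hx, hcf, hD, real_inner_smul_left, real_inner_smul_right, inner_sub_right,
      real_inner_self_eq_norm_sq]
    ring
  rw [hD] at hpos
  have hs : ⟪f, q⟫ ^ 2 ≤ ‖f‖ ^ 2 * ‖q‖ ^ 2 := by
    rw [← mul_pow]
    exact sq_le_sq' (neg_le_of_abs_le (abs_real_inner_le_norm f q)) (real_inner_le_norm f q)
  have hd_nonneg := sq_nonneg ‖f - q‖
  have hfs : 0 < ‖f‖ ^ 2 - ⟪f, q⟫ := by linarith
  have hle : γ ≤ γ' := by
    rw [hγ'_eq]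
    refine le_mul_of_one_le_right hγ.le ?_
    rw [one_le_div hpos]
    linarith
  refine ⟨hle, hγ, ?_⟩
  have hγ'_pos : 0 < γ' := hγ.trans_le hle
  set t := γ / γ' with ht
  have ht_nonneg : 0 ≤ t := by positivity
  have ht_le : t ≤ 1 := (div_le_one hγ'_pos).2 hle
  have ht_eq : t = (‖f‖ ^ 2 - ‖q‖ ^ 2) / (2 * (‖f‖ ^ 2 - ⟪f, q⟫)) := by
    rw [ht, hγ'_eq]
    field_simp
  have hmem : t • q ∈ segment ℝ 0 q :=
    ⟨1 - t, t, by linarith, ht_nonneg, by ring, by simp⟩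
  have hdist : Metric.infDist f' (segment ℝ 0 q) ≤ t * ‖f - q‖ := by
    refine (Metric.infDist_le_dist_of_mem hmem).trans_eq ?_
    have hf't : f' = t • f := by rw [hf', hcf, smul_smul, ht, div_eq_inv_mul]
    rw [hf't, dist_eq_norm, ← smul_sub, norm_smul, Real.norm_of_nonneg ht_nonneg]
  have hF : 0 < ‖f‖ ^ 2 := by linarith [sq_nonneg ‖q‖]
  have hratio : t ^ 2 ≤ 1 - ‖f - q‖ ^ 2 / (4 * ‖f‖ ^ 2) := by
    have key := sq_sub_mul_le_of_sq_le_mul hs (by linarith) (by linarith)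
    have hrhs : 1 - ‖f - q‖ ^ 2 / (4 * ‖f‖ ^ 2) =
        (3 * ‖f‖ ^ 2 + 2 * ⟪f, q⟫ - ‖q‖ ^ 2) / (4 * ‖f‖ ^ 2) := by
      rw [hd, eq_div_iff (by positivity), sub_mul, div_mul_cancel₀ _ (by positivity)]
      ring
    rw [ht_eq, hrhs, div_pow, div_le_div_iff₀ (by positivity) (by positivity)]
    linear_combination 4 * key
  calc Metric.infDist f' (segment ℝ 0 q) ^ 2
      ≤ (t * ‖f - q‖) ^ 2 := pow_le_pow_left₀ Metric.infDist_nonneg hdist 2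
    _ = t ^ 2 * ‖f - q‖ ^ 2 := mul_pow _ _ _
    _ ≤ (1 - ‖f - q‖ ^ 2 / (4 * ‖f‖ ^ 2)) * ‖f - q‖ ^ 2 := by gcongr
    _ ≤ (1 - ‖f - q‖ ^ 2 / (4 * ρ ^ 2)) * ‖f - q‖ ^ 2 := by gcongr
end

section
/- Let ρ > 0 and let f, q, a ∈ ℝⁿ with ‖f‖ ≤ ρ, ‖q‖ ≤ ρ, ‖a‖ ≤ ρ, and ⟨f−q, f+q⟩ > 0. Set x = (2/⟨f−q, f+q⟩)·(f−q) and assume ⟨a, x⟩ > 1. Then dist([q, a], f)² ≤ (1 − ‖f−q‖²/(16ρ²))·‖f−q‖². -/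
open scoped RealInnerProductSpace

theorem stmt_7 {n : ℕ} (ρ : ℝ) (hρ : 0 < ρ) (f q a x : EuclideanSpace ℝ (Fin n))
    (hf : ‖f‖ ≤ ρ) (hq : ‖q‖ ≤ ρ) (ha : ‖a‖ ≤ ρ)
    (hpos : 0 < ⟪f - q, f + q⟫)
    (hx : x = (2 / ⟪f - q, f + q⟫) • (f - q))
    (hax : 1 < ⟪a, x⟫) :
    Metric.infDist f (segment ℝ q a) ^ 2 ≤
      (1 - ‖f - q‖ ^ 2 / (16 * ρ ^ 2)) * ‖f - q‖ ^ 2 := by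
  rw [hx, real_inner_smul_right, div_mul_eq_mul_div, one_lt_div hpos] at hax
  have hsum : f + q = (f - q) + (2 : ℝ) • q := by module
  have hinner : ‖f - q‖ ^ 2 ≤ 2 * ⟪f - q, a - q⟫ := by
    rw [hsum, inner_add_right, real_inner_self_eq_norm_sq, real_inner_smul_right,
      real_inner_comm] at hax
    rw [real_inner_comm, inner_sub_left]
    linarith
  have hd : ‖f - q‖ ^ 2 ≤ 4 * ρ ^ 2 := by
    have := norm_sub_le f q
    nlinarith [norm_nonneg (f - q)]
  have hv : ‖a - q‖ ^ 2 ≤ 4 * ρ ^ 2 := by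
    have := norm_sub_le a q
    nlinarith [norm_nonneg (a - q)]
  obtain ⟨t, ht⟩ : ∃ t : ℝ, t = ‖f - q‖ ^ 2 / (8 * ρ ^ 2) := ⟨_, rfl⟩
  have ht0 : 0 ≤ t := by rw [ht]; positivity
  have ht1 : t ≤ 1 := by
    rw [ht, div_le_one (by positivity)]
    nlinarith [sq_nonneg ρ]
  have hmem : q + t • (a - q) ∈ segment ℝ q a := by
    rw [segment_eq_image']
    exact ⟨t, ⟨ht0, ht1⟩, rfl⟩
  have hexp : ‖f - (q + t • (a - q))‖ ^ 2 =
      ‖f - q‖ ^ 2 - 2 * (t * ⟪f - q, a - q⟫) + t ^ 2 * ‖a - q‖ ^ 2 := by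
    rw [← sub_sub, norm_sub_sq_real, real_inner_smul_right, norm_smul, mul_pow,
      Real.norm_eq_abs, sq_abs]
  calc Metric.infDist f (segment ℝ q a) ^ 2
      ≤ ‖f - (q + t • (a - q))‖ ^ 2 := by
        rw [← dist_eq_norm]
        exact pow_le_pow_left₀ Metric.infDist_nonneg (Metric.infDist_le_dist_of_mem hmem) 2
    _ ≤ ‖f - q‖ ^ 2 - t * ‖f - q‖ ^ 2 + t ^ 2 * (4 * ρ ^ 2) := by
        rw [hexp]
        have h₁ := mul_le_mul_of_nonneg_left hinner ht0
        have h₂ := mul_le_mul_of_nonneg_left hv (sq_nonneg t)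
        linarith
    _ = (1 - ‖f - q‖ ^ 2 / (16 * ρ ^ 2)) * ‖f - q‖ ^ 2 := by
        rw [ht]
        field_simp
        ring
end

section
/- Let K ⊆ ℝⁿ be a compact convex set with r·𝔹₂ ⊆ K ⊆ R·𝔹₂ for some 0 < r ≤ R, let c ∈ ℝⁿ \ {0}, and let 𝒜 = {a ∈ ℝⁿ : ⟨a, x⟩ ≤ 1 for all x ∈ K}. Suppose sequences (γ_t)_{t≥1} of positive reals and (q_t)_{t≥1} in ℝⁿ satisfy q₁ = 0 and, for each t ≥ 1 with f_t := c/γ_t: (i) if ⟨f_t−q_t, f_t+q_t⟩ ≤ 0, then γ_{t+1} = γ_t and q_{t+1} minimizes ‖f_t − q‖ over q ∈ [0, q_t]; (ii) otherwise, setting x_t = (2/⟨f_t−q_t, f_t+q_t⟩)·(f_t−q_t): if x_t ∈ K then γ_{t+1} = ⟨c, x_t⟩ and q_{t+1} minimizes ‖c/γ_{t+1} − q‖ over q ∈ [0, q_t]; if x_t ∉ K then γ_{t+1} = γ_t and there exists a_t ∈ 𝒜 with ⟨a_t, x_t⟩ > 1 such that q_{t+1} minimizes ‖f_t − q‖ over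 q ∈ [a_t, q_t]. Then, with ρ := max(1/r, ‖c‖/γ₁), for every t ≥ 1 one has ‖f_t − q_t‖ ≤ 4ρ/√t. -/
open scoped RealInnerProductSpace

section

variable {V : Type*} [NormedAddCommGroup V] [InnerProductSpace ℝ V]

/-- A point of the polar of a set containing the ball of radius `r` has norm at most `1 / r`. -/
theorem norm_le_one_div_of_forall_inner_le_one {K : Set V} {r : ℝ} (hr : 0 < r)
    (hK : Metric.closedBall 0 r ⊆ K) {a : V} (ha : ∀ x ∈ K, ⟪a, x⟫ ≤ 1) : ‖a‖ ≤ 1 / r := by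
  rcases eq_or_ne a 0 with rfl | h0
  · simpa using hr.le
  have hpos : 0 < ‖a‖ := norm_pos_iff.mpr h0
  have hmem : (r / ‖a‖) • a ∈ K := by
    refine hK ?_
    rw [mem_closedBall_zero_iff, norm_smul, Real.norm_of_nonneg (by positivity),
      div_mul_cancel₀ _ hpos.ne']
  have h := ha _ hmem
  rw [real_inner_smul_right, real_inner_self_eq_norm_sq] at h
  rw [le_div_iff₀ hr]
  calc ‖a‖ * r = r / ‖a‖ * ‖a‖ ^ 2 := by field_simp
    _ ≤ 1 := h

/-- A Frank–Wolfe type line search towards a point that makes a large angle with the residual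
decreases the squared distance. -/
theorem norm_sub_sq_decrease_of_inner {f q a q' : V} {ρ : ℝ} (hρ : 0 < ρ) (hf : ‖f‖ ≤ ρ)
    (hq : ‖q‖ ≤ ρ) (ha : ‖a‖ ≤ ρ) (hang : ‖f - q‖ ^ 2 ≤ 2 * ⟪a - q, f - q⟫)
    (hmin : ∀ p ∈ segment ℝ a q, ‖f - q'‖ ≤ ‖f - p‖) :
    16 * ρ ^ 2 * ‖f - q'‖ ^ 2 ≤ 16 * ρ ^ 2 * ‖f - q‖ ^ 2 - (‖f - q‖ ^ 2) ^ 2 := by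
  have hd : ‖f - q‖ ≤ 2 * ρ := (norm_sub_le _ _).trans (by linarith)
  have hD : ‖a - q‖ ≤ 2 * ρ := (norm_sub_le _ _).trans (by linarith)
  have hd2 : ‖f - q‖ ^ 2 ≤ 4 * ρ ^ 2 := by nlinarith [norm_nonneg (f - q)]
  have hD2 : ‖a - q‖ ^ 2 ≤ 4 * ρ ^ 2 := by nlinarith [norm_nonneg (a - q)]
  set s := ‖f - q‖ ^ 2 with hs
  have hs0 : 0 ≤ s := by positivity
  set l := s / (8 * ρ ^ 2) with hl
  have hl0 : 0 ≤ l := by positivity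
  have hl1 : l ≤ 1 := by
    rw [hl, div_le_one (by positivity)]
    nlinarith [sq_nonneg ρ]
  have hsl : s = l * (8 * ρ ^ 2) := by rw [hl]; field_simp
  have h := hmin (l • a + (1 - l) • q) ⟨l, 1 - l, hl0, by linarith, by ring, rfl⟩
  have hexp : ‖f - (l • a + (1 - l) • q)‖ ^ 2
      = s - 2 * l * ⟪a - q, f - q⟫ + l ^ 2 * ‖a - q‖ ^ 2 := by
    have e : f - (l • a + (1 - l) • q) = (f - q) - l • (a - q) := by module
    rw [e, norm_sub_sq_real, norm_smul, real_inner_smul_right, real_inner_comm, mul_pow,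
      Real.norm_eq_abs, sq_abs, hs]
    ring
  have h2 : ‖f - q'‖ ^ 2 ≤ ‖f - (l • a + (1 - l) • q)‖ ^ 2 :=
    pow_le_pow_left₀ (norm_nonneg _) h 2
  have h3 : ‖f - q'‖ ^ 2 ≤ s - l * s + l ^ 2 * (4 * ρ ^ 2) := by
    rw [hexp] at h2
    nlinarith [mul_le_mul_of_nonneg_left hang hl0,
      mul_le_mul_of_nonneg_left hD2 (sq_nonneg l)]
  calc 16 * ρ ^ 2 * ‖f - q'‖ ^ 2
      ≤ 16 * ρ ^ 2 * (s - l * s + l ^ 2 * (4 * ρ ^ 2)) := by gcongr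
    _ = 16 * ρ ^ 2 * s - s ^ 2 := by rw [hsl]; ring

/-- Rescaling the target so that the candidate point becomes tight decreases the squared
distance to the segment `[0, q]`. -/
theorem norm_sub_sq_decrease_of_smul {f q q' : V} {ρ μ : ℝ} (hρ : 0 < ρ) (hf : ‖f‖ ≤ ρ)
    (hq : ‖q‖ ≤ ρ) (hpos : 0 < ⟪f - q, f + q⟫)
    (hμ : μ * (2 * ⟪f, f - q⟫) = ⟪f - q, f + q⟫)
    (hmin : ∀ p ∈ segment ℝ 0 q, ‖μ • f - q'‖ ≤ ‖μ • f - p‖) :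
    0 ≤ μ ∧ μ ≤ 1 ∧
      16 * ρ ^ 2 * ‖μ • f - q'‖ ^ 2 ≤ 16 * ρ ^ 2 * ‖f - q‖ ^ 2 - (‖f - q‖ ^ 2) ^ 2 := by
  have hd : ‖f - q‖ ≤ 2 * ρ := (norm_sub_le _ _).trans (by linarith)
  have hsum : 2 * ⟪f, f - q⟫ = ⟪f - q, f + q⟫ + ‖f - q‖ ^ 2 := by
    rw [← real_inner_self_eq_norm_sq, ← inner_add_right, real_inner_comm,
      show f + q + (f - q) = (2 : ℝ) • f by module, real_inner_smul_right]
  have hub : 2 * ⟪f, f - q⟫ ≤ 4 * ρ ^ 2 := by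
    nlinarith [real_inner_le_norm f (f - q),
      mul_le_mul hf hd (norm_nonneg _) hρ.le]
  set s := ‖f - q‖ ^ 2 with hs
  set A := 2 * ⟪f, f - q⟫ with hA
  have hs0 : 0 ≤ s := by positivity
  have hA0 : 0 < A := by linarith
  have hμ0 : 0 ≤ μ := by
    by_contra! h
    nlinarith
  have hμA : (1 - μ) * A = s := by linarith
  have hμ1 : μ ≤ 1 := by
    by_contra! h
    nlinarith
  refine ⟨hμ0, hμ1, ?_⟩
  have h := hmin (μ • q) ⟨1 - μ, μ, by linarith, hμ0, by ring, by simp⟩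
  rw [← smul_sub, norm_smul, Real.norm_of_nonneg hμ0] at h
  have h2 : ‖μ • f - q'‖ ^ 2 ≤ μ * s := by
    calc ‖μ • f - q'‖ ^ 2 ≤ (μ * ‖f - q‖) ^ 2 := pow_le_pow_left₀ (norm_nonneg _) h 2
      _ = μ * (μ * s) := by rw [hs]; ring
      _ ≤ μ * s := mul_le_mul_of_nonneg_left (by nlinarith) hμ0
  have h3 : s ≤ (1 - μ) * (4 * ρ ^ 2) := by
    rw [← hμA]
    exact mul_le_mul_of_nonneg_left hub (by linarith)
  have hρ2 : 0 < 16 * ρ ^ 2 := by positivity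
  have h5 : s * s ≤ s * ((1 - μ) * (16 * ρ ^ 2)) :=
    mul_le_mul_of_nonneg_left (by nlinarith) hs0
  nlinarith [mul_le_mul_of_nonneg_left h2 hρ2.le]

end

/-- One step of the recursion `s' ≤ s - s² / M`, which preserves the bound `s ≤ M / t`. -/
theorem mul_add_one_le_of_quadratic_decrease {s s' M t : ℝ} (hM : 0 < M) (ht : 0 ≤ t)
    (hsM : s ≤ M) (hst : s * t ≤ M) (h : M * s' ≤ M * s - s ^ 2) : s' * (t + 1) ≤ M := by
  have h1 : M * s' * (t + 1) ≤ (M * s - s ^ 2) * (t + 1) :=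
    mul_le_mul_of_nonneg_right h (by linarith)
  have h2 : s * t * (M - s) ≤ M * (M - s) := mul_le_mul_of_nonneg_right hst (by linarith)
  refine le_of_mul_le_mul_left ?_ hM
  nlinarith [sq_nonneg s]

theorem stmt_8 {n : ℕ} (K : Set (EuclideanSpace ℝ (Fin n)))
    (r R : ℝ) (hr : 0 < r) (hrR : r ≤ R)
    (hKcompact : IsCompact K) (hKconvex : Convex ℝ K)
    (hKinner : Metric.closedBall 0 r ⊆ K) (hKouter : K ⊆ Metric.closedBall 0 R)
    (c : EuclideanSpace ℝ (Fin n)) (hc : c ≠ 0)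
    (γ : ℕ → ℝ) (q : ℕ → EuclideanSpace ℝ (Fin n))
    (f : ℕ → EuclideanSpace ℝ (Fin n))
    (hγpos : ∀ t, 1 ≤ t → 0 < γ t)
    (hf : ∀ t, 1 ≤ t → f t = (γ t)⁻¹ • c)
    (hq1 : q 1 = 0)
    (hstep : ∀ t, 1 ≤ t →
      -- case (i): the current dual point is "long"
      (⟪f t - q t, f t + q t⟫ ≤ 0 ∧ γ (t + 1) = γ t ∧
        q (t + 1) ∈ segment ℝ 0 (q t) ∧
        ∀ p ∈ segment ℝ 0 (q t), ‖f t - q (t + 1)‖ ≤ ‖f t - p‖) ∨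
      -- case (ii a): the candidate point is feasible
      (0 < ⟪f t - q t, f t + q t⟫ ∧
        (2 / ⟪f t - q t, f t + q t⟫) • (f t - q t) ∈ K ∧
        γ (t + 1) = ⟪c, (2 / ⟪f t - q t, f t + q t⟫) • (f t - q t)⟫ ∧
        q (t + 1) ∈ segment ℝ 0 (q t) ∧
        ∀ p ∈ segment ℝ 0 (q t),
          ‖(γ (t + 1))⁻¹ • c - q (t + 1)‖ ≤ ‖(γ (t + 1))⁻¹ • c - p‖) ∨
      -- case (ii b): the candidate point is infeasible, oracle returns a cut
      (0 < ⟪f t - q t, f t + q t⟫ ∧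
        (2 / ⟪f t - q t, f t + q t⟫) • (f t - q t) ∉ K ∧
        γ (t + 1) = γ t ∧
        ∃ a : EuclideanSpace ℝ (Fin n), (∀ x ∈ K, ⟪a, x⟫ ≤ 1) ∧
          1 < ⟪a, (2 / ⟪f t - q t, f t + q t⟫) • (f t - q t)⟫ ∧
          q (t + 1) ∈ segment ℝ a (q t) ∧
          ∀ p ∈ segment ℝ a (q t), ‖f t - q (t + 1)‖ ≤ ‖f t - p‖)) :
    ∀ t, 1 ≤ t → ‖f t - q t‖ ≤ 4 * max (1 / r) (‖c‖ / γ 1) / Real.sqrt t := by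
  set ρ := max (1 / r) (‖c‖ / γ 1) with hρdef
  have hρ : 0 < ρ := lt_of_lt_of_le (by positivity) (le_max_left _ _)
  have hseg : ∀ {a b p : EuclideanSpace ℝ (Fin n)}, ‖a‖ ≤ ρ → ‖b‖ ≤ ρ → p ∈ segment ℝ a b →
      ‖p‖ ≤ ρ := by
    intro a b p ha hb hp
    exact mem_closedBall_zero_iff.mp ((convex_closedBall _ _).segment_subset
      (mem_closedBall_zero_iff.mpr ha) (mem_closedBall_zero_iff.mpr hb) hp)
  have h0 : ‖(0 : EuclideanSpace ℝ (Fin n))‖ ≤ ρ := by simpa using hρ.le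
  have key : ∀ t : ℕ, 1 ≤ t →
      ‖f t‖ ≤ ρ ∧ ‖q t‖ ≤ ρ ∧ ‖f t - q t‖ ^ 2 * t ≤ 16 * ρ ^ 2 := by
    intro t ht
    induction t, ht using Nat.le_induction with
    | base =>
      have hf1 : ‖f 1‖ ≤ ρ := by
        rw [hf 1 le_rfl, norm_smul, Real.norm_of_nonneg (inv_nonneg.mpr (hγpos 1 le_rfl).le),
          inv_mul_eq_div]
        exact le_max_right _ _
      refine ⟨hf1, by rw [hq1]; exact h0, ?_⟩
      rw [hq1, sub_zero]
      push_cast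
      nlinarith [norm_nonneg (f 1)]
    | succ t ht ih =>
      obtain ⟨hft, hqt, hst⟩ := ih
      have hsM : ‖f t - q t‖ ^ 2 ≤ 16 * ρ ^ 2 := by
        have hd : ‖f t - q t‖ ≤ 2 * ρ := (norm_sub_le _ _).trans (by linarith)
        nlinarith [norm_nonneg (f t - q t)]
      suffices h : ‖f (t + 1)‖ ≤ ρ ∧ ‖q (t + 1)‖ ≤ ρ ∧
          16 * ρ ^ 2 * ‖f (t + 1) - q (t + 1)‖ ^ 2 ≤
            16 * ρ ^ 2 * ‖f t - q t‖ ^ 2 - (‖f t - q t‖ ^ 2) ^ 2 by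
        refine ⟨h.1, h.2.1, ?_⟩
        push_cast
        exact mul_add_one_le_of_quadratic_decrease (by positivity) (by positivity) hsM hst h.2.2
      have hsum : ⟪f t - q t, f t + q t⟫ = ‖f t - q t‖ ^ 2 + 2 * ⟪q t, f t - q t⟫ := by
        rw [← real_inner_self_eq_norm_sq, real_inner_comm (f t - q t) (q t),
          ← real_inner_smul_right, ← inner_add_right]
        congr 1
        module
      have hfeq : γ (t + 1) = γ t → f (t + 1) = f t := fun h => by
        rw [hf t ht, hf (t + 1) (by omega), h]
      rcases hstep t ht with ⟨hle, hγ, hmem, hmin⟩ | ⟨hpos, -, hγ, hmem, hmin⟩ |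
        ⟨hpos, -, hγ, a, haK, hax, hmem, hmin⟩
      · rw [hfeq hγ]
        refine ⟨hft, hseg h0 hqt hmem, norm_sub_sq_decrease_of_inner hρ hft hqt h0 ?_ hmin⟩
        rw [zero_sub, inner_neg_left]
        linarith
      · have hγt := hγpos t ht
        have hγt' := hγpos (t + 1) (by omega)
        have hc' : c = γ t • f t := by rw [hf t ht, smul_inv_smul₀ hγt.ne']
        have hf' : f (t + 1) = ((γ (t + 1))⁻¹ * γ t) • f t := by
          rw [hf (t + 1) (by omega), mul_smul, ← hc']
        rw [← hf (t + 1) (by omega), hf'] at hmin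
        rw [hc', real_inner_smul_left, real_inner_smul_right] at hγ
        have hμ : (γ (t + 1))⁻¹ * γ t * (2 * ⟪f t, f t - q t⟫) = ⟪f t - q t, f t + q t⟫ := by
          rw [mul_assoc, inv_mul_eq_iff_eq_mul₀ hγt'.ne', hγ]
          field_simp
        obtain ⟨hμ0, hμ1, hdec⟩ := norm_sub_sq_decrease_of_smul hρ hft hqt hpos hμ hmin
        rw [hf']
        refine ⟨?_, hseg h0 hqt hmem, hdec⟩
        rw [norm_smul, Real.norm_of_nonneg hμ0]
        exact (mul_le_of_le_one_left (norm_nonneg _) hμ1).trans hft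
      · have ha : ‖a‖ ≤ ρ :=
          (norm_le_one_div_of_forall_inner_le_one hr hKinner haK).trans (le_max_left _ _)
        rw [hfeq hγ]
        refine ⟨hft, hseg ha hqt hmem, norm_sub_sq_decrease_of_inner hρ hft hqt ha ?_ hmin⟩
        rw [real_inner_smul_right, div_mul_eq_mul_div, one_lt_div hpos] at hax
        rw [inner_sub_left]
        linarith
  intro t ht
  obtain ⟨-, -, h⟩ := key t ht
  have ht0 : (0 : ℝ) < t := by exact_mod_cast ht
  rw [le_div_iff₀ (Real.sqrt_pos.mpr ht0)]
  refine (sq_le_sq₀ (by positivity) (by positivity)).mp ?_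
  rw [mul_pow, Real.sq_sqrt ht0.le]
  linarith
end

section
/- Let K ⊆ ℝⁿ be a compact convex set with r·𝔹₂ ⊆ K ⊆ R·𝔹₂ for some 0 < r ≤ R, let c ∈ ℝⁿ \ {0}, and let 𝒜 = {a ∈ ℝⁿ : ⟨a, x⟩ ≤ 1 for all x ∈ K}. Suppose sequences (γ_t)_{t≥1} of positive reals and (q_t)_{t≥1} in ℝⁿ satisfy γ₁ ≥ (r/2)·‖c‖, γ₁ ≤ max{⟨c,x⟩ : x ∈ K}, q₁ = 0, and, for each t ≥ 1 with f_t := c/γ_t: (i) if ⟨f_t−q_t, f_t+q_t⟩ ≤ 0, then γ_{t+1} = γ_t and q_{t+1} minimizes ‖f_t − q‖ over q ∈ [0, q_t]; (ii) otherwise, setting x_t = (2/⟨f_t−q_t, f_t+q_t⟩)·(f_t−q_t): if x_t ∈ K then γ_{t+1} = ⟨c, x_t⟩ and q_{t+1} minimizes ‖c/γ_{t+1} − q‖ over q ∈ [0, q_t]; if x_t ∉ K then γ_{t+1} = γ_t and there exists a_t ∈ 𝒜 with ⟨a_t, x_t⟩ > 1 such that q_{t+1} minimizes ‖f_t − q‖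 over q ∈ [a_t, q_t]. Then for every t ≥ 1: γ_t ≤ max{⟨c,x⟩ : x ∈ K} ≤ (1 + 8R/(r·√t))·γ_t. -/
open scoped RealInnerProductSpace

section

variable {E : Type*} [NormedAddCommGroup E] [InnerProductSpace ℝ E]

theorem convex_polar (K : Set E) : Convex ℝ {a : E | ∀ x ∈ K, ⟪a, x⟫ ≤ 1} := by
  intro a ha b hb s t hs ht hst x hx
  rw [inner_add_left, real_inner_smul_left, real_inner_smul_left]
  nlinarith [mul_le_mul_of_nonneg_left (ha x hx) hs, mul_le_mul_of_nonneg_left (hb x hx) ht]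

theorem mul_norm_le_one_of_mem_polar {K : Set E} {r : ℝ} (hr : 0 < r)
    (hK : Metric.closedBall 0 r ⊆ K) {a : E} (ha : ∀ x ∈ K, ⟪a, x⟫ ≤ 1) : r * ‖a‖ ≤ 1 := by
  rcases eq_or_ne a 0 with rfl | h0
  · simp
  have hn : ‖a‖ ≠ 0 := norm_ne_zero_iff.mpr h0
  have hmem : (r / ‖a‖) • a ∈ K := by
    apply hK
    rw [mem_closedBall_zero_iff, norm_smul, norm_div, norm_norm, div_mul_cancel₀ _ hn,
      Real.norm_of_nonneg hr.le]
  have h := ha _ hmem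
  rw [real_inner_smul_right, real_inner_self_eq_norm_sq] at h
  calc r * ‖a‖ = r / ‖a‖ * ‖a‖ ^ 2 := by field_simp
    _ ≤ 1 := h

/-- Decrease of the squared distance to `f` after one exact line search on `[a, q]`, along a
direction that makes substantial progress towards `f`. -/
theorem norm_sub_sq_decrease_of_segment {r : ℝ} {f q a z : E}
    (ha : r * ‖a‖ ≤ 1) (hq : r * ‖q‖ ≤ 1) (hr : 0 < r) (hfq : r ^ 2 * ‖f - q‖ ^ 2 ≤ 4)
    (hprog : ⟪f - q, f + q⟫ / 2 ≤ ⟪f - q, a⟫)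
    (hz : ∀ p ∈ segment ℝ a q, ‖f - z‖ ≤ ‖f - p‖) :
    ‖f - z‖ ^ 2 * (16 + r ^ 2 * ‖f - q‖ ^ 2) ≤ 16 * ‖f - q‖ ^ 2 := by
  set h := ‖f - q‖ ^ 2 with hh
  have h0 : 0 ≤ h := by positivity
  have hprog' : h / 2 ≤ ⟪f - q, a - q⟫ := by
    have e : h = ⟪f - q, f + q⟫ - 2 * ⟪f - q, q⟫ := by
      rw [hh, ← real_inner_self_eq_norm_sq, inner_add_right, inner_sub_right (f - q) f q]; ring
    rw [inner_sub_right]; linarith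
  have hd : r ^ 2 * ‖a - q‖ ^ 2 ≤ 4 := by
    have h1 : r * ‖a - q‖ ≤ 2 := by
      nlinarith [mul_le_mul_of_nonneg_left (norm_sub_le a q) hr.le]
    have h2 : 0 ≤ r * ‖a - q‖ := by positivity
    nlinarith
  set s := r ^ 2 * h / 8 with hs
  have hs0 : 0 ≤ s := by positivity
  have hmem : s • a + (1 - s) • q ∈ segment ℝ a q :=
    ⟨s, 1 - s, hs0, by linarith, by ring, rfl⟩
  have hle := pow_le_pow_left₀ (norm_nonneg _) (hz _ hmem) 2
  have e : f - (s • a + (1 - s) • q) = (f - q) - s • (a - q) := by module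
  rw [e, norm_sub_sq_real (f - q), real_inner_smul_right, norm_smul, mul_pow, Real.norm_eq_abs, sq_abs,
    ← hh] at hle
  have h3 : ‖f - z‖ ^ 2 ≤ h - r ^ 2 * h ^ 2 / 16 := by
    have h4 := mul_le_mul_of_nonneg_left hprog' hs0
    have h5 := mul_le_mul_of_nonneg_left hd (by positivity : 0 ≤ r ^ 2 * h ^ 2 / 64)
    have e1 : s ^ 2 * ‖a - q‖ ^ 2 = r ^ 2 * h ^ 2 / 64 * (r ^ 2 * ‖a - q‖ ^ 2) := by rw [hs]; ring
    have e2 : s * (h / 2) = r ^ 2 * h ^ 2 / 16 := by rw [hs]; ring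
    linarith
  have h6 := mul_le_mul_of_nonneg_right h3 (by positivity : 0 ≤ 16 + r ^ 2 * h)
  have h7 : 0 ≤ r ^ 4 * h ^ 3 / 16 := by positivity
  nlinarith

/-- The update of the objective value in terms of `f = c / g`. -/
theorem inner_smul_sub_eq {c f q : E} {g : ℝ} (hg : 0 < g) (hf : f = g⁻¹ • c)
    (hA : 0 < ⟪f - q, f + q⟫) :
    ⟪c, (2 / ⟪f - q, f + q⟫) • (f - q)⟫ = g * (1 + ‖f - q‖ ^ 2 / ⟪f - q, f + q⟫) := by
  have hc : c = g • f := by rw [hf, smul_smul, mul_inv_cancel₀ hg.ne', one_smul]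
  have e : 2 * ⟪f, f - q⟫ = ⟪f - q, f + q⟫ + ‖f - q‖ ^ 2 := by
    rw [← real_inner_self_eq_norm_sq]
    simp only [inner_sub_left, inner_sub_right, inner_add_right, real_inner_comm q f]
    ring
  rw [hc, real_inner_smul_left, real_inner_smul_right]
  field_simp
  linarith

/-- Decrease of the squared distance to `c / g` when the objective value `g` is improved. -/
theorem norm_sub_sq_decrease_of_rescale {r g g' : ℝ} {c f q z : E}
    (hf : f = g⁻¹ • c) (hfn : r ^ 2 * ‖f‖ ^ 2 ≤ 4)
    (hA : 0 < ⟪f - q, f + q⟫) (hg' : g' = g * (1 + ‖f - q‖ ^ 2 / ⟪f - q, f + q⟫))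
    (hz : ∀ p ∈ segment ℝ 0 q, ‖g'⁻¹ • c - z‖ ≤ ‖g'⁻¹ • c - p‖) :
    ‖g'⁻¹ • c - z‖ ^ 2 * (16 + r ^ 2 * ‖f - q‖ ^ 2) ≤ 16 * ‖f - q‖ ^ 2 := by
  set A := ⟪f - q, f + q⟫ with hAdef
  set h := ‖f - q‖ ^ 2 with hh
  have h0 : 0 ≤ h := by positivity
  have hAle : r ^ 2 * A ≤ 4 := by
    have e : A = ‖f‖ ^ 2 - ‖q‖ ^ 2 := by
      rw [hAdef, ← real_inner_self_eq_norm_sq, ← real_inner_self_eq_norm_sq]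
      simp only [inner_sub_left, inner_add_right, real_inner_comm q f]
      ring
    rw [e]
    nlinarith [mul_nonneg (sq_nonneg r) (sq_nonneg ‖q‖)]
  set k := 1 + h / A with hk
  have hk1 : 1 ≤ k := by
    have : 0 ≤ h / A := by positivity
    linarith
  have hkinv : k⁻¹ ≤ 1 := inv_le_one_of_one_le₀ hk1
  have hk0 : 0 ≤ k⁻¹ := by positivity
  have hmem : k⁻¹ • q ∈ segment ℝ 0 q := ⟨1 - k⁻¹, k⁻¹, by linarith, hk0, by ring, by simp⟩
  have hle := hz _ hmem
  have e : g'⁻¹ • c - k⁻¹ • q = k⁻¹ • (f - q) := by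
    rw [hg', hf, mul_inv, mul_comm, smul_sub, smul_smul]
  rw [e, norm_smul, Real.norm_of_nonneg hk0] at hle
  have hle2 := pow_le_pow_left₀ (norm_nonneg _) hle 2
  rw [mul_pow, ← hh] at hle2
  have hkr : 16 + r ^ 2 * h ≤ 16 * k := by
    have : r ^ 2 * h ≤ 4 * (h / A) := by
      rw [← mul_div_assoc, le_div_iff₀ hA]
      nlinarith
    have : 0 ≤ h / A := by positivity
    linarith
  calc _ ≤ (k⁻¹ ^ 2 * h) * (16 * k) := by gcongr
    _ = 16 * h * k⁻¹ := by field_simp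
    _ ≤ 16 * h := mul_le_of_le_one_right (by positivity) hkinv

end

theorem reciprocal_rate_step {r h h' s : ℝ} (hs : 0 < s) (hh : 0 ≤ h) (hinv : r ^ 2 * h * s ≤ 16)
    (hstep : h' * (16 + r ^ 2 * h) ≤ 16 * h) : r ^ 2 * h' * (s + 1) ≤ 16 := by
  have hp : 0 < 16 + r ^ 2 * h := by positivity
  have h1 : h' ≤ 16 * h / (16 + r ^ 2 * h) := (le_div_iff₀ hp).mpr hstep
  calc r ^ 2 * h' * (s + 1) ≤ r ^ 2 * (16 * h / (16 + r ^ 2 * h)) * (s + 1) := by gcongr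
    _ = 16 * (r ^ 2 * h * s + r ^ 2 * h) / (16 + r ^ 2 * h) := by field_simp
    _ ≤ 16 := by
      rw [div_le_iff₀ hp]
      linarith

theorem stmt_9 {n : ℕ} (K : Set (EuclideanSpace ℝ (Fin n)))
    (r R : ℝ) (hr : 0 < r) (hrR : r ≤ R)
    (hKcompact : IsCompact K) (hKconvex : Convex ℝ K)
    (hKinner : Metric.closedBall 0 r ⊆ K) (hKouter : K ⊆ Metric.closedBall 0 R)
    (c : EuclideanSpace ℝ (Fin n)) (hc : c ≠ 0)
    (OPT : ℝ) (hOPT : IsGreatest ((fun x => ⟪c, x⟫) '' K) OPT)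
    (γ : ℕ → ℝ) (q : ℕ → EuclideanSpace ℝ (Fin n))
    (f : ℕ → EuclideanSpace ℝ (Fin n))
    (hγpos : ∀ t, 1 ≤ t → 0 < γ t)
    (hγ1lb : r / 2 * ‖c‖ ≤ γ 1) (hγ1ub : γ 1 ≤ OPT)
    (hf : ∀ t, 1 ≤ t → f t = (γ t)⁻¹ • c)
    (hq1 : q 1 = 0)
    (hstep : ∀ t, 1 ≤ t →
      (⟪f t - q t, f t + q t⟫ ≤ 0 ∧ γ (t + 1) = γ t ∧
        q (t + 1) ∈ segment ℝ 0 (q t) ∧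
        ∀ p ∈ segment ℝ 0 (q t), ‖f t - q (t + 1)‖ ≤ ‖f t - p‖) ∨
      (0 < ⟪f t - q t, f t + q t⟫ ∧
        (2 / ⟪f t - q t, f t + q t⟫) • (f t - q t) ∈ K ∧
        γ (t + 1) = ⟪c, (2 / ⟪f t - q t, f t + q t⟫) • (f t - q t)⟫ ∧
        q (t + 1) ∈ segment ℝ 0 (q t) ∧
        ∀ p ∈ segment ℝ 0 (q t),
          ‖(γ (t + 1))⁻¹ • c - q (t + 1)‖ ≤ ‖(γ (t + 1))⁻¹ • c - p‖) ∨
      (0 < ⟪f t - q t, f t + q t⟫ ∧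
        (2 / ⟪f t - q t, f t + q t⟫) • (f t - q t) ∉ K ∧
        γ (t + 1) = γ t ∧
        ∃ a : EuclideanSpace ℝ (Fin n), (∀ x ∈ K, ⟪a, x⟫ ≤ 1) ∧
          1 < ⟪a, (2 / ⟪f t - q t, f t + q t⟫) • (f t - q t)⟫ ∧
          q (t + 1) ∈ segment ℝ a (q t) ∧
          ∀ p ∈ segment ℝ a (q t), ‖f t - q (t + 1)‖ ≤ ‖f t - p‖)) :
    ∀ t, 1 ≤ t → γ t ≤ OPT ∧ OPT ≤ (1 + 8 * R / (r * Real.sqrt t)) * γ t := by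
  have hle_opt : ∀ x ∈ K, ⟪c, x⟫ ≤ OPT := fun x hx => hOPT.2 ⟨x, hx, rfl⟩
  have hzero : ∀ x ∈ K, ⟪(0 : EuclideanSpace ℝ (Fin n)), x⟫ ≤ 1 := by simp
  have hfbound : ∀ t, 1 ≤ t → γ 1 ≤ γ t → r ^ 2 * ‖f t‖ ^ 2 ≤ 4 := by
    intro t ht hmono
    have hpos := hγpos t ht
    have h1 : r * ‖f t‖ ≤ 2 := by
      rw [hf t ht, norm_smul, norm_inv, Real.norm_of_nonneg hpos.le, inv_mul_eq_div,
        ← mul_div_assoc, div_le_iff₀ hpos]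
      linarith
    have h2 : 0 ≤ r * ‖f t‖ := by positivity
    nlinarith
  have hinv : ∀ t, 1 ≤ t → γ 1 ≤ γ t ∧ γ t ≤ OPT ∧ (∀ x ∈ K, ⟪q t, x⟫ ≤ 1) ∧
      r ^ 2 * ‖f t - q t‖ ^ 2 * (t + 3) ≤ 16 := by
    intro t ht
    induction t, ht using Nat.le_induction with
    | base =>
      refine ⟨le_rfl, hγ1ub, by simp [hq1], ?_⟩
      have := hfbound 1 le_rfl le_rfl
      rw [hq1, sub_zero]
      norm_num
      linarith
    | succ t ht ih =>
      obtain ⟨hmono, hopt, hqK, hrate⟩ := ih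
      have hfn := hfbound t ht hmono
      have hqn := mul_norm_le_one_of_mem_polar hr hKinner hqK
      have ht1 : (1 : ℝ) ≤ t := by exact_mod_cast ht
      have hD : r ^ 2 * ‖f t - q t‖ ^ 2 ≤ 4 := by
        have : 0 ≤ r ^ 2 * ‖f t - q t‖ ^ 2 := by positivity
        nlinarith
      have hconv := convex_polar K
      have hrate_succ : ‖f (t + 1) - q (t + 1)‖ ^ 2 * (16 + r ^ 2 * ‖f t - q t‖ ^ 2) ≤
          16 * ‖f t - q t‖ ^ 2 →
          r ^ 2 * ‖f (t + 1) - q (t + 1)‖ ^ 2 * (((t + 1 : ℕ) : ℝ) + 3) ≤ 16 := by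
        intro h
        have := reciprocal_rate_step (by positivity) (by positivity) hrate h
        push_cast
        linarith
      have hfsucc : γ (t + 1) = γ t → f (t + 1) = f t := by
        intro h
        rw [hf (t + 1) (by omega), hf t ht, h]
      rcases hstep t ht with ⟨hA, hγ, hseg, hmin⟩ | ⟨hA, hxK, hγ, hseg, hmin⟩ |
        ⟨hA, hxK, hγ, a, haK, hax, hseg, hmin⟩
      · refine ⟨hγ ▸ hmono, hγ ▸ hopt, hconv.segment_subset hzero hqK hseg, hrate_succ ?_⟩
        rw [hfsucc hγ]
        refine norm_sub_sq_decrease_of_segment (by simp) hqn hr hD ?_ hmin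
        rw [inner_zero_right]
        linarith
      · have hγ' := hγ.trans (inner_smul_sub_eq (hγpos t ht) (hf t ht) hA)
        refine ⟨?_, hγ ▸ hle_opt _ hxK, hconv.segment_subset hzero hqK hseg, hrate_succ ?_⟩
        · refine hmono.trans ?_
          rw [hγ']
          exact le_mul_of_one_le_right (hγpos t ht).le (le_add_of_nonneg_right (by positivity))
        · rw [hf (t + 1) (by omega)]
          exact norm_sub_sq_decrease_of_rescale (hf t ht) hfn hA hγ' hmin
      · refine ⟨hγ ▸ hmono, hγ ▸ hopt, hconv.segment_subset haK hqK hseg, hrate_succ ?_⟩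
        rw [hfsucc hγ]
        refine norm_sub_sq_decrease_of_segment
          (mul_norm_le_one_of_mem_polar hr hKinner haK) hqn hr hD ?_ hmin
        rw [real_inner_smul_right, div_mul_eq_mul_div, lt_div_iff₀ hA, real_inner_comm (f t - q t) a] at hax
        linarith
  intro t ht
  obtain ⟨-, hopt, hqK, hrate⟩ := hinv t ht
  refine ⟨hopt, ?_⟩
  have hpos := hγpos t ht
  have ht0 : (0 : ℝ) < t := by exact_mod_cast ht
  have hsqrt : 0 < Real.sqrt t := Real.sqrt_pos.mpr ht0
  have hR : 0 < R := hr.trans_le hrR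
  have hdist : ‖f t - q t‖ ≤ 8 / (r * Real.sqrt t) := by
    rw [le_div_iff₀ (by positivity)]
    refine le_of_sq_le_sq ?_ (by norm_num)
    rw [mul_pow, mul_pow, Real.sq_sqrt ht0.le]
    have : 0 ≤ r ^ 2 * ‖f t - q t‖ ^ 2 := by positivity
    nlinarith
  obtain ⟨x, hxK, hx⟩ := hOPT.1
  have hxR : ‖x‖ ≤ R := mem_closedBall_zero_iff.mp (hKouter hxK)
  have hc' : c = γ t • f t := by rw [hf t ht, smul_smul, mul_inv_cancel₀ hpos.ne', one_smul]
  calc OPT = ⟪f t, x⟫ * γ t := by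
        rw [← hx]
        nth_rw 1 [hc']
        simp only [real_inner_smul_left]
        ring
    _ = (⟪q t, x⟫ + ⟪f t - q t, x⟫) * γ t := by rw [inner_sub_left]; ring
    _ ≤ (1 + ‖f t - q t‖ * ‖x‖) * γ t := by
        gcongr
        · exact hqK x hxK
        · exact real_inner_le_norm _ _
    _ ≤ (1 + 8 / (r * Real.sqrt t) * R) * γ t := by gcongr
    _ = (1 + 8 * R / (r * Real.sqrt t)) * γ t := by ring
end

section
/- Let K ⊆ ℝⁿ be a compact convex set, let z ∈ ℝⁿ and 0 < r ≤ R with z + r·𝔹₂ ⊆ K ⊆ R·𝔹₂, and let c ∈ ℝⁿ with ‖c‖ = 1. Let γ ∈ ℝ, set f = (c, γ) ∈ ℝⁿ × ℝ, let q ∈ ℝⁿ × ℝ be a convex combination of finitely many pairs (a_j, b_j), each of which either satisfies ‖a_j‖ = 1 and ⟨a_j, x⟩ ≤ b_j for all x ∈ K, or equals (0, R), let λ ∈ (0, 1], and set p = (1−λ)·q − λ·f. Then for every x ∈ K one has ⟨c, x⟩ − γ ≤ (2R/λ)·‖p‖_R. -/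
open scoped RealInnerProductSpace

/-- A convex combination of inequalities valid at `x` is valid at `x`. -/
theorem inner_sum_smul_le_sum_mul {E ι : Type*} [NormedAddCommGroup E] [InnerProductSpace ℝ E]
    (s : Finset ι) {μ b : ι → ℝ} {a : ι → E} {x : E}
    (hμ : ∀ j ∈ s, 0 ≤ μ j) (h : ∀ j ∈ s, ⟪a j, x⟫ ≤ b j) :
    ⟪∑ j ∈ s, μ j • a j, x⟫ ≤ ∑ j ∈ s, μ j * b j := by
  rw [sum_inner]
  refine Finset.sum_le_sum fun j hj => ?_
  rw [real_inner_smul_left]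
  exact mul_le_mul_of_nonneg_left (h j hj) (hμ j hj)

/-- Cauchy–Schwarz for the norm `√(‖a‖² + b² / R²)`, with a non-optimal constant. -/
theorem sub_inner_le_two_mul_sqrt {E : Type*} [NormedAddCommGroup E] [InnerProductSpace ℝ E]
    {R : ℝ} (hR : 0 < R) {x : E} (hx : ‖x‖ ≤ R) (a : E) (b : ℝ) :
    b - ⟪a, x⟫ ≤ 2 * R * √(‖a‖ ^ 2 + b ^ 2 / R ^ 2) := by
  have ha : ‖a‖ ≤ √(‖a‖ ^ 2 + b ^ 2 / R ^ 2) :=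
    Real.le_sqrt_of_sq_le (le_add_of_nonneg_right (by positivity))
  have hb : b / R ≤ √(‖a‖ ^ 2 + b ^ 2 / R ^ 2) :=
    Real.le_sqrt_of_sq_le (by rw [div_pow]; exact le_add_of_nonneg_left (by positivity))
  have hb' := (div_le_iff₀ hR).1 hb
  have hinner : -⟪a, x⟫ ≤ ‖a‖ * R :=
    (neg_le_abs _).trans <| (abs_real_inner_le_norm a x).trans <|
      mul_le_mul_of_nonneg_left hx (norm_nonneg a)
  have ha' := mul_le_mul_of_nonneg_right ha hR.le
  linarith

theorem stmt_13 {n : ℕ} (K : Set (EuclideanSpace ℝ (Fin n)))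
    (z : EuclideanSpace ℝ (Fin n)) (r R : ℝ) (hr : 0 < r) (hrR : r ≤ R)
    (hKcompact : IsCompact K) (hKconvex : Convex ℝ K)
    (hKinner : Metric.closedBall z r ⊆ K) (hKouter : K ⊆ Metric.closedBall 0 R)
    (c : EuclideanSpace ℝ (Fin n)) (hc : ‖c‖ = 1) (γ : ℝ)
    (m : ℕ) (μ : Fin m → ℝ) (a : Fin m → EuclideanSpace ℝ (Fin n)) (b : Fin m → ℝ)
    (hμ : ∀ j, 0 ≤ μ j) (hμsum : ∑ j, μ j = 1)
    (hvalid : ∀ j, (‖a j‖ = 1 ∧ ∀ x ∈ K, ⟪a j, x⟫ ≤ b j) ∨ (a j = 0 ∧ b j = R))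
    (q : EuclideanSpace ℝ (Fin n) × ℝ) (hq : q = (∑ j, μ j • a j, ∑ j, μ j * b j))
    (l : ℝ) (hl : l ∈ Set.Ioc (0 : ℝ) 1)
    (p : EuclideanSpace ℝ (Fin n) × ℝ)
    (hp : p = (1 - l) • q - l • ((c, γ) : EuclideanSpace ℝ (Fin n) × ℝ)) :
    ∀ x ∈ K, ⟪c, x⟫ - γ ≤ (2 * R / l) * Real.sqrt (‖p.1‖ ^ 2 + p.2 ^ 2 / R ^ 2) := by
  intro x hx
  obtain ⟨hl0, hl1⟩ := hl
  have hR : 0 < R := hr.trans_le hrR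
  have hxR : ‖x‖ ≤ R := mem_closedBall_zero_iff.1 (hKouter hx)
  have hqx : ⟪q.1, x⟫ ≤ q.2 := by
    rw [hq]
    refine inner_sum_smul_le_sum_mul Finset.univ (fun j _ => hμ j) fun j _ => ?_
    rcases hvalid j with ⟨-, h⟩ | ⟨ha, hb⟩
    · exact h x hx
    · rw [ha, hb, inner_zero_left]
      exact hR.le
  have hp1 : ⟪p.1, x⟫ = (1 - l) * ⟪q.1, x⟫ - l * ⟪c, x⟫ := by
    simp [hp, inner_sub_left, real_inner_smul_left]
  have hp2 : p.2 = (1 - l) * q.2 - l * γ := by simp [hp]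
  have hpx := sub_inner_le_two_mul_sqrt hR hxR p.1 p.2
  have hq' := mul_le_mul_of_nonneg_left hqx (sub_nonneg.2 hl1)
  rw [div_mul_eq_mul_div, le_div_iff₀ hl0]
  linarith
end

section
/- Let K ⊆ ℝⁿ be a compact convex set, let z ∈ ℝⁿ and 0 < r ≤ R with z + r·𝔹₂ ⊆ K ⊆ R·𝔹₂, and let c ∈ ℝⁿ with ‖c‖ = 1. Let γ ∈ ℝ, set f = (c, γ) ∈ ℝⁿ × ℝ, let q ∈ ℝⁿ × ℝ be a convex combination of finitely many pairs (a_j, b_j), each of which either satisfies ‖a_j‖ = 1 and ⟨a_j, x⟩ ≤ b_j for all x ∈ K, or equals (0, R), let λ ∈ [0, 1/2), and set p = (1−λ)·q − λ·f. If 2R·‖p‖_R ≤ r/4, then γ > ⟨c, z⟩ and λ ≥ r/(4·(γ − ⟨c, z⟩)). -/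
open scoped RealInnerProductSpace

theorem stmt_14 {n : ℕ} (K : Set (EuclideanSpace ℝ (Fin n)))
    (z : EuclideanSpace ℝ (Fin n)) (r R : ℝ) (hr : 0 < r) (hrR : r ≤ R)
    (hKcompact : IsCompact K) (hKconvex : Convex ℝ K)
    (hKinner : Metric.closedBall z r ⊆ K) (hKouter : K ⊆ Metric.closedBall 0 R)
    (c : EuclideanSpace ℝ (Fin n)) (hc : ‖c‖ = 1) (γ : ℝ)
    (m : ℕ) (μ : Fin m → ℝ) (a : Fin m → EuclideanSpace ℝ (Fin n)) (b : Fin m → ℝ)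
    (hμ : ∀ j, 0 ≤ μ j) (hμsum : ∑ j, μ j = 1)
    (hvalid : ∀ j, (‖a j‖ = 1 ∧ ∀ x ∈ K, ⟪a j, x⟫ ≤ b j) ∨ (a j = 0 ∧ b j = R))
    (q : EuclideanSpace ℝ (Fin n) × ℝ) (hq : q = (∑ j, μ j • a j, ∑ j, μ j * b j))
    (l : ℝ) (hl : l ∈ Set.Ico (0 : ℝ) (1 / 2))
    (p : EuclideanSpace ℝ (Fin n) × ℝ)
    (hp : p = (1 - l) • q - l • ((c, γ) : EuclideanSpace ℝ (Fin n) × ℝ))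
    (hpsmall : 2 * R * Real.sqrt (‖p.1‖ ^ 2 + p.2 ^ 2 / R ^ 2) ≤ r / 4) :
    ⟪c, z⟫ < γ ∧ r / (4 * (γ - ⟪c, z⟫)) ≤ l := by
  have hR : 0 < R := hr.trans_le hrR
  have hzK : z ∈ K := hKinner (Metric.mem_closedBall_self hr.le)
  have hz : ‖z‖ ≤ R := by simpa using hKouter hzK
  have hslack : ∀ j, r ≤ b j - ⟪a j, z⟫ := by
    intro j
    rcases hvalid j with ⟨ha, hb⟩ | ⟨ha, hb⟩
    · have hmem : z + r • a j ∈ K := hKinner (by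
        simp [Metric.mem_closedBall, dist_eq_norm, norm_smul, ha, abs_of_pos hr])
      have h := hb _ hmem
      rw [inner_add_right, real_inner_smul_right, real_inner_self_eq_norm_sq, ha] at h
      linarith
    · simpa [ha, hb] using hrR
  have hqslack : r ≤ q.2 - ⟪q.1, z⟫ := by
    have hsum : q.2 - ⟪q.1, z⟫ = ∑ j, μ j * (b j - ⟪a j, z⟫) := by
      simp only [hq, sum_inner, real_inner_smul_left, mul_sub, Finset.sum_sub_distrib]
    calc r = ∑ j, μ j * r := by rw [← Finset.sum_mul, hμsum, one_mul]
      _ ≤ ∑ j, μ j * (b j - ⟪a j, z⟫) :=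
        Finset.sum_le_sum fun j _ => mul_le_mul_of_nonneg_left (hslack j) (hμ j)
      _ = q.2 - ⟪q.1, z⟫ := hsum.symm
  have hpval : p.2 - ⟪p.1, z⟫ = (1 - l) * (q.2 - ⟪q.1, z⟫) - l * (γ - ⟪c, z⟫) := by
    simp only [hp, Prod.fst_sub, Prod.snd_sub, Prod.smul_fst, Prod.smul_snd, inner_sub_left,
      real_inner_smul_left, smul_eq_mul]
    ring
  have hnorm_fst : ‖p.1‖ ≤ Real.sqrt (‖p.1‖ ^ 2 + p.2 ^ 2 / R ^ 2) :=
    Real.le_sqrt_of_sq_le (le_add_of_nonneg_right (by positivity))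
  have hsnd : p.2 / R ≤ Real.sqrt (‖p.1‖ ^ 2 + p.2 ^ 2 / R ^ 2) := by
    apply Real.le_sqrt_of_sq_le
    rw [div_pow]
    exact le_add_of_nonneg_left (by positivity)
  have hpbound : p.2 - ⟪p.1, z⟫ ≤ r / 4 := by
    have hinner : -⟪p.1, z⟫ ≤ ‖p.1‖ * R :=
      (neg_le_abs _).trans ((abs_real_inner_le_norm _ _).trans
        (mul_le_mul_of_nonneg_left hz (norm_nonneg _)))
    have hfst_mul := mul_le_mul_of_nonneg_right hnorm_fst hR.le
    rw [div_le_iff₀ hR] at hsnd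
    linarith
  obtain ⟨hl0, hl1⟩ := hl
  have hgap : r / 4 ≤ l * (γ - ⟪c, z⟫) := by
    have hhalf : (1 / 2) * r ≤ (1 - l) * (q.2 - ⟪q.1, z⟫) :=
      mul_le_mul (by linarith) hqslack hr.le (by linarith)
    linarith
  have hpos : 0 < γ - ⟪c, z⟫ :=
    pos_of_mul_pos_right (lt_of_lt_of_le (by positivity) hgap) hl0
  refine ⟨sub_pos.mp hpos, ?_⟩
  rw [div_le_iff₀ (by positivity)]
  linarith
end

section
/- Let K ⊆ ℝⁿ be a compact convex set, let z ∈ ℝⁿ and 0 < r ≤ R with z + r·𝔹₂ ⊆ K ⊆ R·𝔹₂, and let c ∈ ℝⁿ with ‖c‖ = 1; write OPT = max{⟨c, x⟩ : x ∈ K}. Let γ ∈ ℝ with γ ≤ OPT, set f = (c, γ) ∈ ℝⁿ × ℝ, let q ∈ ℝⁿ × ℝ be a convex combination of finitely many pairs (a_j, b_j), each of which either satisfies ‖a_j‖ = 1 and ⟨a_j, x⟩ ≤ b_j for all x ∈ K, or equals (0, R), let λ ∈ [0, 1], and set p = (1−λ)·q − λ·f. If ‖p‖_R ≤ r/(8R),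 then OPT ≤ γ + (8R·(OPT − ⟨c, z⟩)/r)·‖p‖_R. -/
open scoped RealInnerProductSpace

/-- A bound for an affine functional on the ball of radius `R`, in terms of the `R`-scaled norm
of its coefficients. -/
theorem sub_inner_le_two_mul_scaledNorm {E : Type*} [NormedAddCommGroup E] [InnerProductSpace ℝ E]
    {R : ℝ} (hR : 0 < R) (u : E) (t : ℝ) {x : E} (hx : ‖x‖ ≤ R) :
    t - ⟪u, x⟫ ≤ 2 * R * Real.sqrt (‖u‖ ^ 2 + t ^ 2 / R ^ 2) := by
  have hu : ‖u‖ ≤ Real.sqrt (‖u‖ ^ 2 + t ^ 2 / R ^ 2) :=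
    Real.le_sqrt_of_sq_le (le_add_of_nonneg_right (by positivity))
  have ht : t / R ≤ Real.sqrt (‖u‖ ^ 2 + t ^ 2 / R ^ 2) := by
    apply Real.le_sqrt_of_sq_le
    rw [div_pow]
    exact le_add_of_nonneg_left (by positivity)
  rw [div_le_iff₀ hR] at ht
  have hinner : -⟪u, x⟫ ≤ ‖u‖ * ‖x‖ := (neg_le_abs _).trans (abs_real_inner_le_norm u x)
  have hmul : ‖u‖ * ‖x‖ ≤ Real.sqrt (‖u‖ ^ 2 + t ^ 2 / R ^ 2) * R := by gcongr
  linarith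

/-- A halfspace with unit normal containing a ball of radius `r` has slack at least `r` at the
centre of the ball. -/
theorem inner_add_le_of_closedBall_subset {E : Type*} [NormedAddCommGroup E]
    [InnerProductSpace ℝ E] {K : Set E} {z : E} {r : ℝ} (hr : 0 ≤ r)
    (hK : Metric.closedBall z r ⊆ K) {u : E} (hu : ‖u‖ = 1) {t : ℝ}
    (h : ∀ x ∈ K, ⟪u, x⟫ ≤ t) : ⟪u, z⟫ + r ≤ t := by
  have hmem : z + r • u ∈ K := hK (by simp [Metric.mem_closedBall, norm_smul, hu, abs_of_nonneg hr])
  have := h _ hmem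
  rwa [inner_add_right, real_inner_smul_right, real_inner_self_eq_norm_sq, hu, one_pow,
    mul_one] at this

/-- A convex combination of affine slacks, each at least `s` at `x`, is at least `s` at `x`. -/
theorem le_sum_mul_sub_inner_sum_smul {E ι : Type*} [NormedAddCommGroup E]
    [InnerProductSpace ℝ E] [Fintype ι] {w : ι → ℝ} (hw : ∀ j, 0 ≤ w j) (hsum : ∑ j, w j = 1)
    {a : ι → E} {b : ι → ℝ} {x : E} {s : ℝ} (h : ∀ j, s ≤ b j - ⟪a j, x⟫) :
    s ≤ ∑ j, w j * b j - ⟪∑ j, w j • a j, x⟫ := by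
  calc s = ∑ j, w j * s := by rw [← Finset.sum_mul, hsum, one_mul]
    _ ≤ ∑ j, w j * (b j - ⟪a j, x⟫) :=
      Finset.sum_le_sum fun j _ => mul_le_mul_of_nonneg_left (h j) (hw j)
    _ = _ := by simp only [sum_inner, real_inner_smul_left, mul_sub, Finset.sum_sub_distrib]

theorem stmt_15 {n : ℕ} (K : Set (EuclideanSpace ℝ (Fin n)))
    (z : EuclideanSpace ℝ (Fin n)) (r R : ℝ) (hr : 0 < r) (hrR : r ≤ R)
    (hKcompact : IsCompact K) (hKconvex : Convex ℝ K)
    (hKinner : Metric.closedBall z r ⊆ K) (hKouter : K ⊆ Metric.closedBall 0 R)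
    (c : EuclideanSpace ℝ (Fin n)) (hc : ‖c‖ = 1)
    (OPT : ℝ) (hOPT : IsGreatest ((fun x => ⟪c, x⟫) '' K) OPT)
    (γ : ℝ) (hγ : γ ≤ OPT)
    (m : ℕ) (μ : Fin m → ℝ) (a : Fin m → EuclideanSpace ℝ (Fin n)) (b : Fin m → ℝ)
    (hμ : ∀ j, 0 ≤ μ j) (hμsum : ∑ j, μ j = 1)
    (hvalid : ∀ j, (‖a j‖ = 1 ∧ ∀ x ∈ K, ⟪a j, x⟫ ≤ b j) ∨ (a j = 0 ∧ b j = R))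
    (q : EuclideanSpace ℝ (Fin n) × ℝ) (hq : q = (∑ j, μ j • a j, ∑ j, μ j * b j))
    (l : ℝ) (hl : l ∈ Set.Icc (0 : ℝ) 1)
    (p : EuclideanSpace ℝ (Fin n) × ℝ)
    (hp : p = (1 - l) • q - l • ((c, γ) : EuclideanSpace ℝ (Fin n) × ℝ))
    (hpsmall : Real.sqrt (‖p.1‖ ^ 2 + p.2 ^ 2 / R ^ 2) ≤ r / (8 * R)) :
    OPT ≤ γ + (8 * R * (OPT - ⟪c, z⟫) / r) * Real.sqrt (‖p.1‖ ^ 2 + p.2 ^ 2 / R ^ 2) := by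
  have hR : 0 < R := hr.trans_le hrR
  have hnorm : ∀ x ∈ K, ‖x‖ ≤ R := fun x hx => mem_closedBall_zero_iff.mp (hKouter hx)
  have hzK : z ∈ K := hKinner (Metric.mem_closedBall_self hr.le)
  obtain ⟨⟨y, hyK, hy⟩, hmax⟩ := hOPT
  replace hy : ⟪c, y⟫ = OPT := hy
  have hD : ⟪c, z⟫ + r ≤ OPT :=
    inner_add_le_of_closedBall_subset hr.le hKinner hc fun x hx => hmax ⟨x, hx, rfl⟩
  have hqz : r ≤ q.2 - ⟪q.1, z⟫ := by
    rw [hq]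
    refine le_sum_mul_sub_inner_sum_smul hμ hμsum fun j => ?_
    rcases hvalid j with ⟨ha, hb⟩ | ⟨ha, hb⟩
    · linarith [inner_add_le_of_closedBall_subset hr.le hKinner ha hb]
    · simpa [ha, hb] using hrR
  have hqy : 0 ≤ q.2 - ⟪q.1, y⟫ := by
    rw [hq]
    refine le_sum_mul_sub_inner_sum_smul hμ hμsum fun j => ?_
    rcases hvalid j with ⟨-, hb⟩ | ⟨ha, hb⟩
    · exact sub_nonneg.mpr (hb y hyK)
    · simpa [ha, hb] using hR.le
  have hsplit : ∀ x, p.2 - ⟪p.1, x⟫ = (1 - l) * (q.2 - ⟪q.1, x⟫) + l * (⟪c, x⟫ - γ) := by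
    intro x
    simp only [hp, Prod.fst_sub, Prod.snd_sub, Prod.smul_fst, Prod.smul_snd, inner_sub_left,
      real_inner_smul_left, smul_eq_mul]
    ring
  have hpy := sub_inner_le_two_mul_scaledNorm hR p.1 p.2 (hnorm y hyK)
  have hpz := sub_inner_le_two_mul_scaledNorm hR p.1 p.2 (hnorm z hzK)
  rw [hsplit] at hpy hpz
  rw [hy] at hpy
  set N := Real.sqrt (‖p.1‖ ^ 2 + p.2 ^ 2 / R ^ 2)
  obtain ⟨hl0, hl1⟩ := hl
  rw [le_div_iff₀ (by positivity)] at hpsmall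
  have hgap : l * (OPT - γ) ≤ 2 * R * N := by
    linarith [mul_nonneg (sub_nonneg.mpr hl1) hqy]
  have hlD : r / 4 ≤ l * (OPT - ⟪c, z⟫) := by
    have h1 := mul_le_mul_of_nonneg_left hqz (sub_nonneg.mpr hl1)
    have h2 := mul_nonneg hl0 (sub_nonneg.mpr hγ)
    have h3 : l * r ≤ l * (OPT - ⟪c, z⟫) := mul_le_mul_of_nonneg_left (by linarith) hl0
    linarith
  have h4 := mul_le_mul_of_nonneg_right hlD (sub_nonneg.mpr hγ)
  have h5 := mul_le_mul_of_nonneg_right hgap (show 0 ≤ OPT - ⟪c, z⟫ by linarith)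
  rw [← sub_le_iff_le_add', div_mul_eq_mul_div, le_div_iff₀ hr]
  linarith
end

section
/- Let m ≥ 1 and let x, y ∈ ℝᵐ with ‖x‖ ≤ √2, ‖y‖ ≤ √2, and ⟨y, x⟩ ≤ 0. Then min{‖p‖² : p ∈ [x, y]} ≤ (1 − ‖x‖²/8)·‖x‖². -/
open scoped RealInnerProductSpace

theorem stmt_16 {m : ℕ} (hm : 1 ≤ m) (x y : EuclideanSpace ℝ (Fin m))
    (hx : ‖x‖ ≤ Real.sqrt 2) (hy : ‖y‖ ≤ Real.sqrt 2) (hxy : ⟪y, x⟫ ≤ 0) :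
    Metric.infDist 0 (segment ℝ x y) ^ 2 ≤ (1 - ‖x‖ ^ 2 / 8) * ‖x‖ ^ 2 := by
  have ha : ‖x‖ ^ 2 ≤ 2 := by simpa using pow_le_pow_left₀ (norm_nonneg x) hx 2
  have hb : ‖y‖ ^ 2 ≤ 2 := by simpa using pow_le_pow_left₀ (norm_nonneg y) hy 2
  have ha0 : 0 ≤ ‖x‖ ^ 2 := sq_nonneg _
  -- The point with parameter `‖x‖ ^ 2 / 4` is close enough to the origin.
  obtain ⟨t, ht⟩ : ∃ t, t = ‖x‖ ^ 2 / 4 := ⟨_, rfl⟩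
  have ht0 : 0 ≤ t := by linarith
  have ht1 : 0 ≤ 1 - t := by linarith
  have hp : (1 - t) • x + t • y ∈ segment ℝ x y := ⟨1 - t, t, ht1, ht0, by ring, rfl⟩
  have hdist : Metric.infDist 0 (segment ℝ x y) ≤ ‖(1 - t) • x + t • y‖ := by
    simpa only [dist_zero_left] using Metric.infDist_le_dist_of_mem (x := 0) hp
  have hnorm : ‖(1 - t) • x + t • y‖ ^ 2 =
      (1 - t) ^ 2 * ‖x‖ ^ 2 + 2 * (t * (1 - t) * ⟪y, x⟫) + t ^ 2 * ‖y‖ ^ 2 := by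
    rw [norm_add_sq_real, norm_smul, norm_smul, real_inner_smul_left, real_inner_smul_right,
      real_inner_comm, mul_pow, mul_pow, Real.norm_eq_abs, Real.norm_eq_abs, sq_abs, sq_abs]
    ring
  have hinner : t * (1 - t) * ⟪y, x⟫ ≤ 0 := mul_nonpos_of_nonneg_of_nonpos (mul_nonneg ht0 ht1) hxy
  have hy' : t ^ 2 * ‖y‖ ^ 2 ≤ t ^ 2 * 2 := mul_le_mul_of_nonneg_left hb (sq_nonneg t)
  have hxt : ‖x‖ ^ 2 = 4 * t := by linarith
  calc Metric.infDist 0 (segment ℝ x y) ^ 2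
      ≤ ‖(1 - t) • x + t • y‖ ^ 2 := pow_le_pow_left₀ Metric.infDist_nonneg hdist 2
    _ ≤ (1 - t) ^ 2 * (4 * t) + t ^ 2 * 2 := by rw [hnorm, hxt]; linarith
    _ ≤ (1 - ‖x‖ ^ 2 / 8) * ‖x‖ ^ 2 := by
      rw [hxt]
      nlinarith [mul_nonneg (sq_nonneg t) ht1]
end

section
/- Let K ⊆ ℝⁿ be a compact convex set, let z ∈ ℝⁿ and 0 < r ≤ R with z + r·𝔹₂ ⊆ K ⊆ R·𝔹₂, and let c ∈ ℝⁿ with ‖c‖ = 1; write OPT = max{⟨c, x⟩ : x ∈ K}. Let γ ∈ ℝ with γ ≤ OPT, set f = (c, γ) ∈ ℝⁿ × ℝ, let q ∈ ℝⁿ × ℝ be a convex combination of finitely many pairs (a_j, b_j), each of which either satisfies ‖a_j‖ = 1 and ⟨a_j, x⟩ ≤ b_j for all x ∈ K, or equals (0, R), let λ ∈ [0, 1], and set p = (1−λ)·q − λ·f. If t ≥ 4096·R²/r² is a real number and ‖p‖_R ≤ 8/√t, then OPT ≤ γ + 128·R²/(r·√t). -/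
open scoped RealInnerProductSpace

/-- If a set contains the ball `closedBall z r`, every valid unit-normal inequality has
slack at least `r` at `z`. -/
lemma inner_add_radius_le_of_closedBall_subset {E : Type*} [NormedAddCommGroup E]
    [InnerProductSpace ℝ E] {K : Set E} {z a : E} {r b : ℝ} (hr : 0 ≤ r)
    (hK : Metric.closedBall z r ⊆ K) (ha : ‖a‖ = 1) (hb : ∀ x ∈ K, ⟪a, x⟫ ≤ b) :
    ⟪a, z⟫ + r ≤ b := by
  have hmem : z + r • a ∈ K := hK (by simp [norm_smul, ha, abs_of_nonneg hr])
  have h := hb _ hmem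
  rw [inner_add_right, inner_smul_right, real_inner_self_eq_norm_sq, ha] at h
  linarith

/-- If every pair `(a j, b j)` has slack at least `s` at `x`, so does every convex combination. -/
lemma le_slack_of_convex_combination {E ι : Type*} [NormedAddCommGroup E]
    [InnerProductSpace ℝ E] [Fintype ι] {μ b : ι → ℝ} {a : ι → E} {x : E} {s : ℝ}
    (hμ : ∀ j, 0 ≤ μ j) (hμsum : ∑ j, μ j = 1) (h : ∀ j, s ≤ b j - ⟪a j, x⟫) :
    s ≤ ∑ j, μ j * b j - ⟪∑ j, μ j • a j, x⟫ := by
  simp only [sum_inner, real_inner_smul_left, ← Finset.sum_sub_distrib, ← mul_sub]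
  calc s = ∑ j, μ j * s := by rw [← Finset.sum_mul, hμsum, one_mul]
    _ ≤ _ := Finset.sum_le_sum fun j _ => mul_le_mul_of_nonneg_left (h j) (hμ j)

/-- An affine functional with small scaled norm `√(‖α‖² + β² / R²)` is small on the ball of
radius `R`. -/
lemma sub_inner_le_of_sqrt_le {E : Type*} [NormedAddCommGroup E] [InnerProductSpace ℝ E]
    {α x : E} {β R ε : ℝ} (hR : 0 < R) (hx : ‖x‖ ≤ R)
    (h : Real.sqrt (‖α‖ ^ 2 + β ^ 2 / R ^ 2) ≤ ε) : β - ⟪α, x⟫ ≤ 2 * R * ε := by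
  have h1 : ‖α‖ ≤ ε :=
    (Real.le_sqrt_of_sq_le (by linarith [show 0 ≤ β ^ 2 / R ^ 2 by positivity])).trans h
  have h2 : β / R ≤ ε :=
    (Real.le_sqrt_of_sq_le (by rw [div_pow]; linarith [sq_nonneg ‖α‖])).trans h
  rw [div_le_iff₀ hR] at h2
  have h3 := neg_le_of_abs_le (abs_real_inner_le_norm α x)
  have h4 : ‖α‖ * ‖x‖ ≤ ε * R := mul_le_mul h1 hx (norm_nonneg _) ((norm_nonneg _).trans h1)
  linarith

theorem stmt_17 {n : ℕ} (K : Set (EuclideanSpace ℝ (Fin n)))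
    (z : EuclideanSpace ℝ (Fin n)) (r R : ℝ) (hr : 0 < r) (hrR : r ≤ R)
    (hKcompact : IsCompact K) (hKconvex : Convex ℝ K)
    (hKinner : Metric.closedBall z r ⊆ K) (hKouter : K ⊆ Metric.closedBall 0 R)
    (c : EuclideanSpace ℝ (Fin n)) (hc : ‖c‖ = 1)
    (OPT : ℝ) (hOPT : IsGreatest ((fun x => ⟪c, x⟫) '' K) OPT)
    (γ : ℝ) (hγ : γ ≤ OPT)
    (m : ℕ) (μ : Fin m → ℝ) (a : Fin m → EuclideanSpace ℝ (Fin n)) (b : Fin m → ℝ)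
    (hμ : ∀ j, 0 ≤ μ j) (hμsum : ∑ j, μ j = 1)
    (hvalid : ∀ j, (‖a j‖ = 1 ∧ ∀ x ∈ K, ⟪a j, x⟫ ≤ b j) ∨ (a j = 0 ∧ b j = R))
    (q : EuclideanSpace ℝ (Fin n) × ℝ) (hq : q = (∑ j, μ j • a j, ∑ j, μ j * b j))
    (l : ℝ) (hl : l ∈ Set.Icc (0 : ℝ) 1)
    (p : EuclideanSpace ℝ (Fin n) × ℝ)
    (hp : p = (1 - l) • q - l • ((c, γ) : EuclideanSpace ℝ (Fin n) × ℝ))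
    (t : ℝ) (ht : 4096 * R ^ 2 / r ^ 2 ≤ t)
    (hpsmall : Real.sqrt (‖p.1‖ ^ 2 + p.2 ^ 2 / R ^ 2) ≤ 8 / Real.sqrt t) :
    OPT ≤ γ + 128 * R ^ 2 / (r * Real.sqrt t) := by
  have hR : 0 < R := hr.trans_le hrR
  have ht0 : 0 < t := lt_of_lt_of_le (by positivity) ht
  have hst : 0 < Real.sqrt t := Real.sqrt_pos.2 ht0
  have hnorm : ∀ x ∈ K, ‖x‖ ≤ R := fun x hx => by simpa using hKouter hx
  have hzK : z ∈ K := hKinner (Metric.mem_closedBall_self hr.le)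
  obtain ⟨⟨x, hxK, hx⟩, -⟩ := hOPT
  replace hx : ⟪c, x⟫ = OPT := hx
  obtain ⟨hl0, hl1⟩ := hl
  have hsqrt : 64 * R / r ≤ Real.sqrt t :=
    Real.le_sqrt_of_sq_le (le_trans (le_of_eq (by ring)) ht)
  have hε : 2 * R * (8 / Real.sqrt t) ≤ r / 4 := by
    rw [div_le_iff₀ hr] at hsqrt
    rw [← mul_div_assoc, div_le_iff₀ hst]
    linarith
  have hslack : ∀ y, p.2 - ⟪p.1, y⟫ = (1 - l) * (q.2 - ⟪q.1, y⟫) + l * (⟪c, y⟫ - γ) := by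
    intro y
    simp only [hp, Prod.fst_sub, Prod.snd_sub, Prod.smul_fst, Prod.smul_snd, inner_sub_left,
      real_inner_smul_left, smul_eq_mul]
    ring
  have hqz : r ≤ q.2 - ⟪q.1, z⟫ := by
    rw [hq]
    refine le_slack_of_convex_combination hμ hμsum fun j => ?_
    rcases hvalid j with ⟨ha, hb⟩ | ⟨ha, hb⟩
    · linarith [inner_add_radius_le_of_closedBall_subset hr.le hKinner ha hb]
    · simpa [ha, hb] using hrR
  have hqx : 0 ≤ q.2 - ⟪q.1, x⟫ := by
    rw [hq]
    refine le_slack_of_convex_combination hμ hμsum fun j => ?_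
    rcases hvalid j with ⟨-, hb⟩ | ⟨ha, hb⟩
    · linarith [hb x hxK]
    · simpa [ha, hb] using hR.le
  have hpx := sub_inner_le_of_sqrt_le hR (hnorm x hxK) hpsmall
  have hpz := sub_inner_le_of_sqrt_le hR (hnorm z hzK) hpsmall
  rw [hslack, hx] at hpx
  rw [hslack] at hpz
  have hcx : OPT ≤ R := by
    have := real_inner_le_norm c x
    rw [hc, hx] at this
    linarith [hnorm x hxK]
  have hcz : -R ≤ ⟪c, z⟫ := by
    have := neg_le_of_abs_le (abs_real_inner_le_norm c z)
    rw [hc] at this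
    linarith [hnorm z hzK]
  have hweight : r ≤ 4 * R * l := by
    have h1 := mul_le_mul_of_nonneg_left hqz (sub_nonneg.2 hl1)
    have h2 : l * (-2 * R) ≤ l * (⟪c, z⟫ - γ) := mul_le_mul_of_nonneg_left (by linarith) hl0
    have h3 := mul_le_mul_of_nonneg_left hrR hl0
    linarith
  have hgap : l * (OPT - γ) ≤ 2 * R * (8 / Real.sqrt t) := by
    linarith [mul_nonneg (sub_nonneg.2 hl1) hqx]
  have hfinal : (OPT - γ) * r ≤ 64 * R ^ 2 / Real.sqrt t := by
    calc (OPT - γ) * r ≤ (OPT - γ) * (4 * R * l) :=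
          mul_le_mul_of_nonneg_left hweight (sub_nonneg.2 hγ)
      _ = 4 * R * (l * (OPT - γ)) := by ring
      _ ≤ 4 * R * (2 * R * (8 / Real.sqrt t)) :=
          mul_le_mul_of_nonneg_left hgap (by positivity)
      _ = 64 * R ^ 2 / Real.sqrt t := by ring
  have hbound : OPT - γ ≤ 128 * R ^ 2 / (r * Real.sqrt t) := by
    rw [mul_comm r, ← div_div, le_div_iff₀ hr]
    exact hfinal.trans (by gcongr; norm_num)
  linarith
end
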